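/- arXiv:1403.5901 — 2 statements merged into one kernel-verified Lean document; each statement's English description precedes it below -/
import Mathlib

section
/- Let N be a norm on the space of real m×n matrices and let A be a nonzero m×n real matrix. The problem min{ N(X) : ⟨A, X⟩ ≥ 1 } has a unique optimal solution if and only if the dual norm function N* is (Fréchet) differentiable at A. -/
open Matrix

noncomputable section

attribute [local instance] Matrix.normedAddCommGroup Matrix.normedSpace

/-- The Frobenius (trace) inner product of two real `m × n` matrices. -/
def fip {m n : ℕ} (A X : Matrix (Fin m) (Fin n) ℝ) : ℝ := (Aᵀ * X).trace

/-- `N` is a norm on the space of real `m × n` matrices. -/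
structure IsMatrixNorm {m n : ℕ} (N : Matrix (Fin m) (Fin n) ℝ → ℝ) : Prop where
  nonneg : ∀ X, 0 ≤ N X
  definite : ∀ X, N X = 0 → X = 0
  smul : ∀ (c : ℝ) (X), N (c • X) = |c| * N X
  triangle : ∀ X Y, N (X + Y) ≤ N X + N Y

/-- The dual norm `N*(A) = sup { ⟨A, Y⟩ : N(Y) ≤ 1 }`. -/
def dualNorm {m n : ℕ} (N : Matrix (Fin m) (Fin n) ℝ → ℝ)
    (A : Matrix (Fin m) (Fin n) ℝ) : ℝ :=
  sSup {r | ∃ Y, N Y ≤ 1 ∧ r = fip A Y}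

section SupportFunction

open Filter Topology Asymptotics

variable {E F : Type*} [NormedAddCommGroup E] [NormedSpace ℝ E]
  [NormedAddCommGroup F] [NormedSpace ℝ F]

/-- The support function of a compact set is differentiable wherever its maximizer is unique. -/
theorem hasFDerivAt_of_unique_maximizer (B : E →L[ℝ] F →L[ℝ] ℝ) {K : Set F} (hK : IsCompact K)
    {D : E → ℝ} (hD : ∀ a, ∀ y ∈ K, B a y ≤ D a) (hatt : ∀ a, ∃ y ∈ K, B a y = D a)
    {a : E} {y₀ : F} (hy₀ : y₀ ∈ K) (ha : B a y₀ = D a)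
    (huniq : ∀ y ∈ K, B a y = D a → y = y₀) :
    HasFDerivAt D (B.flip y₀) a := by
  choose s hsK hs using hatt
  obtain ⟨C, hC⟩ := hK.isBounded.exists_norm_le
  have hsub : Tendsto (fun b : E => ‖b - a‖) (𝓝 a) (𝓝 0) := by
    have : Continuous fun b : E => ‖b - a‖ := by fun_prop
    simpa using this.tendsto a
  have hlim₁ : Tendsto (fun b => B (b - a) (s b)) (𝓝 a) (𝓝 0) := by
    refine squeeze_zero_norm (a := fun b => ‖B‖ * ‖b - a‖ * C) (fun b => ?_) ?_
    · exact (B.le_opNorm₂ _ _).trans (by gcongr; exact hC _ (hsK b))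
    · simpa using (hsub.const_mul ‖B‖).mul_const C
  have hlim₂ : Tendsto (fun b => B b y₀) (𝓝 a) (𝓝 (D a)) := by
    have : Continuous fun b => B b y₀ := by fun_prop
    simpa [ha] using this.tendsto a
  have hval : Tendsto (fun b => B a (s b)) (𝓝 a) (𝓝 (D a)) := by
    refine tendsto_of_tendsto_of_tendsto_of_le_of_le (g := fun b => B b y₀ - B (b - a) (s b))
      (by simpa using hlim₂.sub hlim₁) tendsto_const_nhds (fun b => ?_) fun b => hD a _ (hsK b)
    have h₁ := hD b y₀ hy₀
    have h₂ := hs b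
    simp only [map_sub, FunLike.coe_sub, Pi.sub_apply]
    linarith
  have hlim : Tendsto s (𝓝 a) (𝓝 y₀) := by
    refine hK.tendsto_nhds_of_unique_mapClusterPt (.of_forall hsK) fun y hy hcl => ?_
    refine huniq y hy ?_
    have h := hcl.continuousAt_comp (B a).continuous.continuousAt
    have : ClusterPt (B a y) (𝓝 (D a)) := ClusterPt.mono h hval
    exact eq_of_nhds_neBot this
  refine .of_isLittleO (isLittleO_iff.2 fun ε hε => ?_)
  have hsmall : ∀ᶠ b in 𝓝 a, ‖B‖ * ‖s b - y₀‖ < ε := by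
    have : Tendsto (fun b => ‖B‖ * ‖s b - y₀‖) (𝓝 a) (𝓝 0) := by
      simpa using ((hlim.sub_const y₀).norm).const_mul ‖B‖
    exact this.eventually_lt_const hε
  filter_upwards [hsmall] with b hb
  have h₁ := hD b y₀ hy₀
  have h₂ := hD a (s b) (hsK b)
  have h₃ := hs b
  have h₄ : B (b - a) (s b - y₀) ≤ ε * ‖b - a‖ := calc
    B (b - a) (s b - y₀) ≤ ‖B‖ * ‖b - a‖ * ‖s b - y₀‖ :=
      (le_abs_self _).trans (B.le_opNorm₂ _ _)
    _ = ‖B‖ * ‖s b - y₀‖ * ‖b - a‖ := by ring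
    _ ≤ ε * ‖b - a‖ := by gcongr
  simp only [map_sub, FunLike.coe_sub, Pi.sub_apply] at h₄
  rw [Real.norm_eq_abs, abs_le]
  simp only [map_sub, ContinuousLinearMap.flip_apply]
  have h₅ : 0 ≤ ε * ‖b - a‖ := by positivity
  constructor <;> linarith

/-- A maximizer gives the derivative of a differentiable support function. -/
theorem fderiv_eq_of_maximizer (B : E →L[ℝ] F →L[ℝ] ℝ) {D : E → ℝ} {a : E} {y : F}
    (hD : ∀ b, B b y ≤ D b) (ha : B a y = D a) (hdiff : DifferentiableAt ℝ D a) :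
    fderiv ℝ D a = B.flip y := by
  have hmin : IsLocalMin (fun b => D b - B.flip y b) a := by
    refine .of_forall fun b => ?_
    have := hD b
    simp only [ContinuousLinearMap.flip_apply]
    linarith
  exact sub_eq_zero.1 <| hmin.hasFDerivAt_eq_zero
    (hdiff.hasFDerivAt.sub (B.flip y).hasFDerivAt)

end SupportFunction

section MatrixNorm

variable {m n : ℕ}

/-- The Frobenius inner product as a continuous bilinear map. -/
def fipL (m n : ℕ) :
    Matrix (Fin m) (Fin n) ℝ →L[ℝ] Matrix (Fin m) (Fin n) ℝ →L[ℝ] ℝ :=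
  (LinearMap.mk₂ ℝ fip (by simp [fip, Matrix.add_mul]) (by simp [fip])
    (by simp [fip, Matrix.mul_add]) (by simp [fip])).toContinuousBilinearMap

theorem fipL_apply (A X : Matrix (Fin m) (Fin n) ℝ) : fipL m n A X = fip A X := rfl

theorem fip_smul_right (c : ℝ) (A X : Matrix (Fin m) (Fin n) ℝ) :
    fip A (c • X) = c * fip A X := by
  simp [fip]

theorem fip_self_pos {A : Matrix (Fin m) (Fin n) ℝ} (hA : A ≠ 0) : 0 < fip A A := by
  have h := Matrix.posSemidef_conjTranspose_mul_self A
  have h₀ : 0 ≤ fip A A := by simpa [fip] using h.trace_nonneg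
  refine h₀.lt_of_ne' fun h₁ => hA (Matrix.trace_conjTranspose_mul_self_eq_zero_iff.1 ?_)
  simpa [fip] using h₁

theorem fipL_flip_injective : Function.Injective (fipL m n).flip := by
  intro X Y h
  by_contra hne
  have h₁ := congrArg (fun f => f (X - Y)) h
  have h₂ := fip_self_pos (sub_ne_zero.2 hne)
  change fipL m n (X - Y) X = fipL m n (X - Y) Y at h₁
  rw [← fipL_apply, map_sub (fipL m n (X - Y)), h₁, sub_self] at h₂
  exact lt_irrefl _ h₂

namespace IsMatrixNorm

variable {N : Matrix (Fin m) (Fin n) ℝ → ℝ}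

theorem map_zero (hN : IsMatrixNorm N) : N 0 = 0 := by
  simpa using hN.smul 0 0

theorem pos (hN : IsMatrixNorm N) {X : Matrix (Fin m) (Fin n) ℝ} (hX : X ≠ 0) : 0 < N X :=
  (hN.nonneg X).lt_of_ne' fun h => hX (hN.definite X h)

theorem continuous (hN : IsMatrixNorm N) : Continuous N := by
  have hconv : ConvexOn ℝ Set.univ N := by
    refine ⟨convex_univ, fun X _ Y _ a b ha hb _ => (hN.triangle _ _).trans_eq ?_⟩
    rw [hN.smul, hN.smul, abs_of_nonneg ha, abs_of_nonneg hb, smul_eq_mul, smul_eq_mul]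
  exact continuousOn_univ.1 (hconv.continuousOn isOpen_univ)

theorem exists_mul_norm_le (hN : IsMatrixNorm N) : ∃ c > 0, ∀ X, c * ‖X‖ ≤ N X := by
  have hcomp : IsCompact (Metric.sphere (0 : Matrix (Fin m) (Fin n) ℝ) 1) := isCompact_sphere _ _
  obtain ⟨c, hc, hmin⟩ : ∃ c > 0, ∀ X ∈ Metric.sphere (0 : Matrix (Fin m) (Fin n) ℝ) 1,
      c ≤ N X := by
    refine hcomp.exists_forall_le' hN.continuous.continuousOn fun X hX => hN.pos ?_
    exact ne_zero_of_mem_unit_sphere ⟨X, hX⟩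
  refine ⟨c, hc, fun X => ?_⟩
  rcases eq_or_ne X 0 with rfl | hX
  · simp [hN.map_zero]
  have hpos : 0 < ‖X‖ := norm_pos_iff.2 hX
  have h := hmin (‖X‖⁻¹ • X) (by simp [norm_smul, hpos.ne'])
  rwa [hN.smul, abs_of_pos (inv_pos.2 hpos), inv_mul_eq_div, le_div_iff₀ hpos] at h

theorem isCompact_unitBall (hN : IsMatrixNorm N) : IsCompact {X | N X ≤ 1} := by
  obtain ⟨c, hc, h⟩ := hN.exists_mul_norm_le
  refine Metric.isCompact_of_isClosed_isBounded (isClosed_le hN.continuous continuous_const) ?_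
  refine isBounded_iff_forall_norm_le.2 ⟨1 / c, fun X hX => ?_⟩
  rw [le_div_iff₀ hc, mul_comm]
  exact (h X).trans hX

theorem isGreatest_dualNorm (hN : IsMatrixNorm N) (A : Matrix (Fin m) (Fin n) ℝ) :
    IsGreatest {r | ∃ Y, N Y ≤ 1 ∧ r = fip A Y} (dualNorm N A) := by
  obtain ⟨Y, hY, hmax⟩ := hN.isCompact_unitBall.exists_isMaxOn
    ⟨0, by simp [hN.map_zero]⟩ (fipL m n A).continuous.continuousOn
  have h : IsGreatest {r | ∃ Y, N Y ≤ 1 ∧ r = fip A Y} (fip A Y) := by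
    refine ⟨⟨Y, hY, rfl⟩, ?_⟩
    rintro _ ⟨Z, hZ, rfl⟩
    exact hmax hZ
  rw [dualNorm, h.csSup_eq]
  exact h

theorem fip_le_dualNorm (hN : IsMatrixNorm N) (A : Matrix (Fin m) (Fin n) ℝ)
    {Y : Matrix (Fin m) (Fin n) ℝ} (hY : N Y ≤ 1) : fip A Y ≤ dualNorm N A :=
  (hN.isGreatest_dualNorm A).2 ⟨Y, hY, rfl⟩

theorem fip_le_dualNorm_mul (hN : IsMatrixNorm N) (A X : Matrix (Fin m) (Fin n) ℝ) :
    fip A X ≤ dualNorm N A * N X := by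
  rcases eq_or_ne X 0 with rfl | hX
  · simp [hN.map_zero, fip]
  have hpos := hN.pos hX
  have h := hN.fip_le_dualNorm A (Y := (N X)⁻¹ • X)
    (by rw [hN.smul, abs_of_pos (inv_pos.2 hpos), inv_mul_cancel₀ hpos.ne'])
  rwa [fip_smul_right, inv_mul_eq_div, div_le_iff₀ hpos] at h

theorem dualNorm_pos (hN : IsMatrixNorm N) {A : Matrix (Fin m) (Fin n) ℝ} (hA : A ≠ 0) :
    0 < dualNorm N A :=
  pos_of_mul_pos_left ((fip_self_pos hA).trans_le (hN.fip_le_dualNorm_mul A A)) (hN.nonneg A)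

/-- The optimal solutions are the maximizers defining the dual norm, scaled by its inverse. -/
theorem isOptimal_iff (hN : IsMatrixNorm N) {A : Matrix (Fin m) (Fin n) ℝ} (hA : A ≠ 0)
    (X : Matrix (Fin m) (Fin n) ℝ) :
    (1 ≤ fip A X ∧ ∀ X', 1 ≤ fip A X' → N X ≤ N X') ↔
      N (dualNorm N A • X) ≤ 1 ∧ fip A (dualNorm N A • X) = dualNorm N A := by
  have hD := hN.dualNorm_pos hA
  rw [hN.smul, fip_smul_right, abs_of_pos hD]
  constructor
  · rintro ⟨h₁, h₂⟩
    obtain ⟨Y, hY, hYD⟩ := (hN.isGreatest_dualNorm A).1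
    have h₃ := h₂ ((dualNorm N A)⁻¹ • Y)
      (by rw [fip_smul_right, ← hYD, inv_mul_cancel₀ hD.ne'])
    rw [hN.smul, abs_of_pos (inv_pos.2 hD), inv_mul_eq_div, le_div_iff₀ hD, mul_comm] at h₃
    have h₄ := hN.fip_le_dualNorm_mul A X
    have h₅ : fip A X = 1 := by linarith
    exact ⟨h₃.trans hY, by rw [h₅, mul_one]⟩
  · rintro ⟨h₁, h₂⟩
    refine ⟨((mul_eq_left₀ hD.ne').1 h₂).ge, fun X' hX' => ?_⟩
    exact le_of_mul_le_mul_left (h₁.trans (hX'.trans (hN.fip_le_dualNorm_mul A X'))) hD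

end IsMatrixNorm

end MatrixNorm

/-- The problem `min { N(X) : ⟨A, X⟩ ≥ 1 }` has a unique optimal solution if and only if
the dual norm function `N*` is (Fréchet) differentiable at `A`. -/
theorem stmt3 {m n : ℕ} (N : Matrix (Fin m) (Fin n) ℝ → ℝ) (hN : IsMatrixNorm N)
    (A : Matrix (Fin m) (Fin n) ℝ) (hA : A ≠ 0) :
    (∃! X, 1 ≤ fip A X ∧ ∀ X', 1 ≤ fip A X' → N X ≤ N X') ↔
      DifferentiableAt ℝ (dualNorm N) A := by
  have hD := (hN.dualNorm_pos hA).ne'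
  have hatt : ∀ B, ∃ Y, N Y ≤ 1 ∧ fip B Y = dualNorm N B := fun B =>
    let ⟨Y, hY, h⟩ := (hN.isGreatest_dualNorm B).1
    ⟨Y, hY, h.symm⟩
  simp only [hN.isOptimal_iff hA]
  constructor
  · rintro ⟨X, ⟨hX₁, hX₂⟩, huniq⟩
    refine (hasFDerivAt_of_unique_maximizer (fipL m n) hN.isCompact_unitBall
      (fun B Y hY => hN.fip_le_dualNorm B hY) hatt hX₁ hX₂ fun Y hY₁ hY₂ => ?_).differentiableAt
    rw [← huniq ((dualNorm N A)⁻¹ • Y) (by simpa only [smul_inv_smul₀ hD] using ⟨hY₁, hY₂⟩),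
      smul_inv_smul₀ hD]
  · intro hdiff
    obtain ⟨Y, hY₁, hY₂⟩ := hatt A
    refine ⟨(dualNorm N A)⁻¹ • Y, by simpa only [smul_inv_smul₀ hD] using ⟨hY₁, hY₂⟩, ?_⟩
    rintro X ⟨hX₁, hX₂⟩
    rw [eq_inv_smul_iff₀ hD]
    apply fipL_flip_injective
    rw [← fderiv_eq_of_maximizer (fipL m n) (fun B => hN.fip_le_dualNorm B hX₁) hX₂ hdiff,
      ← fderiv_eq_of_maximizer (fipL m n) (fun B => hN.fip_le_dualNorm B hY₁) hY₂ hdiff]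
end
end

section
/- Let N be a norm on the space of real m×n matrices, let θ > 0, and define the norm N_θ(X) = N(X) + θ‖X‖₁. Then for every m×n real matrix A, the dual norm of N_θ at A satisfies N_θ*(A) = min{ max{ N*(Y), θ⁻¹‖Z‖_∞ } : Y + Z = A }, and this minimum is attained by some pair (Y, Z) with Y + Z = A. -/
open Matrix

noncomputable section

/-- `‖X‖₁`: the sum of the absolute values of all entries of `X`. -/
def l1Norm {m n : ℕ} (X : Matrix (Fin m) (Fin n) ℝ) : ℝ := ∑ i, ∑ j, |X i j|

/-- `‖X‖_∞`: the maximum absolute value of the entries of `X`. -/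
def linfNorm {m n : ℕ} (X : Matrix (Fin m) (Fin n) ℝ) : ℝ := ⨆ i, ⨆ j, |X i j|

/-- A linear functional on a finite-dimensional space is bounded with respect to any norm. -/
lemma exists_forall_le_mul_of_norm {E : Type*} [AddCommGroup E] [Module ℝ E]
    [FiniteDimensional ℝ E] (N : E → ℝ) (nonneg : ∀ x, 0 ≤ N x)
    (definite : ∀ x, N x = 0 → x = 0) (smul : ∀ (c : ℝ) (x), N (c • x) = |c| * N x)
    (triangle : ∀ x y, N (x + y) ≤ N x + N y) (f : E →ₗ[ℝ] ℝ) :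
    ∃ C, 0 ≤ C ∧ ∀ x, f x ≤ C * N x := by
  let _ : Norm E := ⟨N⟩
  have core : NormedSpace.Core ℝ E :=
    { norm_nonneg := nonneg
      norm_smul := smul
      norm_triangle := triangle
      norm_eq_zero_iff := fun x =>
        ⟨definite x, fun h => by
          subst h
          have h0 : N 0 = 0 := by simpa using smul 0 0
          exact h0⟩ }
  let _ : NormedAddCommGroup E := NormedAddCommGroup.ofCore core
  let _ : NormedSpace ℝ E := NormedSpace.ofCore core
  refine ⟨‖f.toContinuousLinearMap‖, norm_nonneg _, fun x => ?_⟩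
  exact (le_abs_self _).trans (f.toContinuousLinearMap.le_opNorm x)

lemma fip_eq_sum {m n : ℕ} (A X : Matrix (Fin m) (Fin n) ℝ) :
    fip A X = ∑ i, ∑ j, A i j * X i j := by
  simp only [fip, Matrix.trace, Matrix.diag, Matrix.mul_apply, Matrix.transpose_apply]
  exact Finset.sum_comm

/-- The Frobenius inner product with a fixed matrix, as a linear functional. -/
def fipLinear {m n : ℕ} (A : Matrix (Fin m) (Fin n) ℝ) :
    Matrix (Fin m) (Fin n) ℝ →ₗ[ℝ] ℝ where
  toFun := fip A
  map_add' X Y := by simp [fip, Matrix.mul_add]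
  map_smul' c X := by simp [fip]

lemma fip_add_left {m n : ℕ} (A B X : Matrix (Fin m) (Fin n) ℝ) :
    fip (A + B) X = fip A X + fip B X := by
  simp [fip, Matrix.add_mul]

lemma fip_of_apply_single {m n : ℕ} (g : Matrix (Fin m) (Fin n) ℝ →ₗ[ℝ] ℝ)
    (X : Matrix (Fin m) (Fin n) ℝ) :
    fip (Matrix.of fun i j => g (Matrix.single i j 1)) X = g X := by
  conv_rhs => rw [Matrix.matrix_eq_sum_single X]
  rw [fip_eq_sum]
  simp only [map_sum, Matrix.of_apply]
  refine Finset.sum_congr rfl fun i _ => Finset.sum_congr rfl fun j _ => ?_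
  have h : Matrix.single i j (X i j) = X i j • Matrix.single i j (1 : ℝ) := by
    simp [Matrix.smul_single]
  rw [h, map_smul, smul_eq_mul, mul_comm]

lemma IsMatrixNorm.map_zero_s4 {m n : ℕ} {N : Matrix (Fin m) (Fin n) ℝ → ℝ}
    (hN : IsMatrixNorm N) : N 0 = 0 := by
  simpa using hN.smul 0 0

lemma IsMatrixNorm.bddAbove {m n : ℕ} {N : Matrix (Fin m) (Fin n) ℝ → ℝ}
    (hN : IsMatrixNorm N) (A : Matrix (Fin m) (Fin n) ℝ) :
    BddAbove {r | ∃ Y, N Y ≤ 1 ∧ r = fip A Y} := by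
  obtain ⟨C, hC, h⟩ := exists_forall_le_mul_of_norm N hN.nonneg hN.definite hN.smul
    hN.triangle (fipLinear A)
  refine ⟨C, ?_⟩
  rintro _ ⟨Y, hY, rfl⟩
  exact (h Y).trans (mul_le_of_le_one_right hC hY)

lemma IsMatrixNorm.fip_le {m n : ℕ} {N : Matrix (Fin m) (Fin n) ℝ → ℝ}
    (hN : IsMatrixNorm N) (A X : Matrix (Fin m) (Fin n) ℝ) :
    fip A X ≤ dualNorm N A * N X := by
  rcases (hN.nonneg X).eq_or_lt with h | h
  · rw [← h, hN.definite X h.symm]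
    simp [fip]
  · have h1 : fip A ((N X)⁻¹ • X) ≤ dualNorm N A := by
      refine le_csSup (hN.bddAbove A) ⟨_, ?_, rfl⟩
      rw [hN.smul, abs_of_pos (inv_pos.2 h), inv_mul_cancel₀ h.ne']
    have h2 : fip A ((N X)⁻¹ • X) = (N X)⁻¹ * fip A X := (fipLinear A).map_smul _ _
    rwa [h2, inv_mul_le_iff₀ h, mul_comm] at h1

lemma IsMatrixNorm.dualNorm_le {m n : ℕ} {N : Matrix (Fin m) (Fin n) ℝ → ℝ}
    (hN : IsMatrixNorm N) {A : Matrix (Fin m) (Fin n) ℝ} {r : ℝ} (hr : 0 ≤ r)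
    (h : ∀ X, fip A X ≤ r * N X) : dualNorm N A ≤ r := by
  refine csSup_le ⟨_, 0, by simp [hN.map_zero_s4], rfl⟩ ?_
  rintro _ ⟨Y, hY, rfl⟩
  exact (h Y).trans (mul_le_of_le_one_right hr hY)

lemma IsMatrixNorm.dualNorm_nonneg {m n : ℕ} {N : Matrix (Fin m) (Fin n) ℝ → ℝ}
    (hN : IsMatrixNorm N) (A : Matrix (Fin m) (Fin n) ℝ) : 0 ≤ dualNorm N A :=
  le_csSup (hN.bddAbove A) ⟨0, by simp [hN.map_zero_s4], by simp [fip]⟩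

lemma l1Norm_nonneg {m n : ℕ} (X : Matrix (Fin m) (Fin n) ℝ) : 0 ≤ l1Norm X :=
  Finset.sum_nonneg fun _ _ => Finset.sum_nonneg fun _ _ => abs_nonneg _

lemma l1Norm_smul {m n : ℕ} (c : ℝ) (X : Matrix (Fin m) (Fin n) ℝ) :
    l1Norm (c • X) = |c| * l1Norm X := by
  simp [l1Norm, abs_mul, Finset.mul_sum]

lemma l1Norm_add_le {m n : ℕ} (X Y : Matrix (Fin m) (Fin n) ℝ) :
    l1Norm (X + Y) ≤ l1Norm X + l1Norm Y := by
  simp only [l1Norm, ← Finset.sum_add_distrib]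
  exact Finset.sum_le_sum fun i _ => Finset.sum_le_sum fun j _ => abs_add_le _ _

lemma l1Norm_single {m n : ℕ} (i : Fin m) (j : Fin n) (c : ℝ) :
    l1Norm (Matrix.single i j c) = |c| := by
  rw [l1Norm, Finset.sum_eq_single i, Finset.sum_eq_single j] <;>
    simp +contextual [Matrix.single_apply, eq_comm]

lemma abs_le_linfNorm {m n : ℕ} (Z : Matrix (Fin m) (Fin n) ℝ) (i : Fin m) (j : Fin n) :
    |Z i j| ≤ linfNorm Z :=
  (le_ciSup (f := fun j => |Z i j|) (Set.finite_range _).bddAbove j).trans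
    (le_ciSup (f := fun i => ⨆ j, |Z i j|) (Set.finite_range _).bddAbove i)

lemma fip_le_linfNorm_mul_l1Norm {m n : ℕ} (Z X : Matrix (Fin m) (Fin n) ℝ) :
    fip Z X ≤ linfNorm Z * l1Norm X := by
  simp only [fip_eq_sum, l1Norm, Finset.mul_sum]
  refine Finset.sum_le_sum fun i _ => Finset.sum_le_sum fun j _ => ?_
  calc Z i j * X i j ≤ |Z i j| * |X i j| := by rw [← abs_mul]; exact le_abs_self _
    _ ≤ linfNorm Z * |X i j| := by gcongr; exact abs_le_linfNorm Z i j

lemma linfNorm_le {m n : ℕ} {Z : Matrix (Fin m) (Fin n) ℝ} {r : ℝ} (hr : 0 ≤ r)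
    (h : ∀ X, fip Z X ≤ r * l1Norm X) : linfNorm Z ≤ r := by
  refine Real.iSup_le (fun i => Real.iSup_le (fun j => ?_) hr) hr
  have key (c : ℝ) : Z i j * c ≤ r * |c| := by
    have := h (Matrix.single i j c)
    rw [l1Norm_single, fip_eq_sum, Finset.sum_eq_single i, Finset.sum_eq_single j] at this
    · simpa using this
    all_goals simp +contextual [Matrix.single_apply, eq_comm]
  have h1 := key 1
  have h2 := key (-1)
  norm_num at h1 h2
  exact abs_le.2 ⟨by linarith, h1⟩

lemma IsMatrixNorm.add_l1Norm {m n : ℕ} {N : Matrix (Fin m) (Fin n) ℝ → ℝ}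
    (hN : IsMatrixNorm N) {θ : ℝ} (hθ : 0 ≤ θ) :
    IsMatrixNorm fun X => N X + θ * l1Norm X where
  nonneg X := add_nonneg (hN.nonneg X) (mul_nonneg hθ (l1Norm_nonneg X))
  definite X h := hN.definite X <| by
    have h1 := hN.nonneg X
    have h2 := mul_nonneg hθ (l1Norm_nonneg X)
    linarith
  smul c X := by rw [hN.smul, l1Norm_smul]; ring
  triangle X Y := by
    have h1 := hN.triangle X Y
    have h2 := mul_le_mul_of_nonneg_left (l1Norm_add_le X Y) hθ
    linarith

/-- A linear functional dominated by a sum of two sublinear functionals splits as a sum of linear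
functionals dominated by each of them. -/
lemma exists_add_eq_of_le_add_sublinear {E : Type*} [AddCommGroup E] [Module ℝ E]
    (f : E →ₗ[ℝ] ℝ) (p q : E → ℝ)
    (hp : ∀ c : ℝ, 0 < c → ∀ x, p (c • x) = c * p x) (hp' : ∀ x y, p (x + y) ≤ p x + p y)
    (hq : ∀ c : ℝ, 0 < c → ∀ x, q (c • x) = c * q x) (hq' : ∀ x y, q (x + y) ≤ q x + q y)
    (hf : ∀ x, f x ≤ p x + q x) :
    ∃ g h : E →ₗ[ℝ] ℝ, g + h = f ∧ (∀ x, g x ≤ p x) ∧ ∀ x, h x ≤ q x := by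
  have zero_of_homog (s : E → ℝ) (hs : ∀ c : ℝ, 0 < c → ∀ x, s (c • x) = c * s x) :
      s 0 = 0 := by
    have := hs 2 two_pos 0
    rw [smul_zero] at this
    linarith
  let D : Submodule ℝ (E × E) := LinearMap.eqLocus (LinearMap.fst ℝ E E) (LinearMap.snd ℝ E E)
  obtain ⟨F, hF, hFle⟩ := exists_extension_of_le_sublinear
    (⟨D, f ∘ₗ LinearMap.fst ℝ E E ∘ₗ D.subtype⟩ : E × E →ₗ.[ℝ] ℝ)
    (fun z => p z.1 + q z.2)
    (fun c hc z => by simp [hp c hc, hq c hc, mul_add])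
    (fun z w => by
      have h1 := hp' z.1 w.1
      have h2 := hq' z.2 w.2
      simp only [Prod.fst_add, Prod.snd_add]
      linarith)
    (by
      rintro ⟨⟨x, y⟩, hxy⟩
      obtain rfl : x = y := hxy
      exact hf x)
  refine ⟨F ∘ₗ LinearMap.inl ℝ E E, F ∘ₗ LinearMap.inr ℝ E E, ?_, fun x => ?_, fun x => ?_⟩
  · ext x
    have h := hF ⟨(x, x), rfl⟩
    have hsum : F (x, 0) + F (0, x) = F (x, x) := by simp [← map_add]
    exact hsum.trans h
  · simpa [zero_of_homog q hq] using hFle (x, 0)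
  · simpa [zero_of_homog p hp] using hFle (0, x)

/-- For `θ > 0` and the norm `N_θ(X) = N(X) + θ‖X‖₁`, the dual norm satisfies
`N_θ*(A) = min { max { N*(Y), θ⁻¹‖Z‖_∞ } : Y + Z = A }`, the minimum being attained. -/
theorem stmt4 {m n : ℕ} (N : Matrix (Fin m) (Fin n) ℝ → ℝ) (hN : IsMatrixNorm N)
    (θ : ℝ) (hθ : 0 < θ) (A : Matrix (Fin m) (Fin n) ℝ) :
    IsLeast {r | ∃ Y Z, Y + Z = A ∧ r = max (dualNorm N Y) (θ⁻¹ * linfNorm Z)}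
      (dualNorm (fun X => N X + θ * l1Norm X) A) := by
  have hM := hN.add_l1Norm hθ.le
  have lower (Y Z : Matrix (Fin m) (Fin n) ℝ) (hYZ : Y + Z = A) :
      dualNorm (fun X => N X + θ * l1Norm X) A ≤
        max (dualNorm N Y) (θ⁻¹ * linfNorm Z) := by
    refine hM.dualNorm_le ((hN.dualNorm_nonneg Y).trans (le_max_left _ _)) fun X => ?_
    set r := max (dualNorm N Y) (θ⁻¹ * linfNorm Z)
    have hZ : linfNorm Z ≤ r * θ := by
      have h : θ⁻¹ * linfNorm Z ≤ r := le_max_right _ _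
      rwa [inv_mul_le_iff₀ hθ, mul_comm] at h
    calc fip A X = fip Y X + fip Z X := by rw [← hYZ, fip_add_left]
      _ ≤ dualNorm N Y * N X + linfNorm Z * l1Norm X :=
        add_le_add (hN.fip_le Y X) (fip_le_linfNorm_mul_l1Norm Z X)
      _ ≤ r * N X + r * θ * l1Norm X :=
        add_le_add (mul_le_mul_of_nonneg_right (le_max_left _ _) (hN.nonneg X))
          (mul_le_mul_of_nonneg_right hZ (l1Norm_nonneg X))
      _ = r * (N X + θ * l1Norm X) := by ring
  refine ⟨?_, fun _ ⟨Y, Z, hYZ, hs⟩ => hs ▸ lower Y Z hYZ⟩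
  have hle := hM.fip_le A
  have hr := hM.dualNorm_nonneg A
  set r := dualNorm (fun X => N X + θ * l1Norm X) A
  obtain ⟨g, h, hgh, hg, hh⟩ := exists_add_eq_of_le_add_sublinear (fipLinear A)
    (fun X => r * N X) (fun X => r * θ * l1Norm X)
    (fun c hc X => by rw [hN.smul, abs_of_pos hc]; ring)
    (fun X Y => by
      rw [← mul_add]
      exact mul_le_mul_of_nonneg_left (hN.triangle X Y) hr)
    (fun c hc X => by rw [l1Norm_smul, abs_of_pos hc]; ring)
    (fun X Y => by
      rw [← mul_add]
      exact mul_le_mul_of_nonneg_left (l1Norm_add_le X Y) (mul_nonneg hr hθ.le))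
    (fun X => (hle X).trans_eq (by ring))
  let Y : Matrix (Fin m) (Fin n) ℝ := Matrix.of fun i j => g (Matrix.single i j 1)
  let Z : Matrix (Fin m) (Fin n) ℝ := Matrix.of fun i j => h (Matrix.single i j 1)
  have hYZ : Y + Z = A := by
    ext i j
    have h1 : g (Matrix.single i j 1) + h (Matrix.single i j 1) = fip A (Matrix.single i j 1) :=
      LinearMap.congr_fun hgh (Matrix.single i j 1)
    refine h1.trans ?_
    rw [fip_eq_sum, Finset.sum_eq_single i, Finset.sum_eq_single j] <;>
      simp +contextual [Matrix.single_apply, eq_comm]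
  refine ⟨Y, Z, hYZ, le_antisymm (lower Y Z hYZ) (max_le ?_ ?_)⟩
  · exact hN.dualNorm_le hr fun X => (fip_of_apply_single g X).trans_le (hg X)
  · rw [inv_mul_le_iff₀ hθ, mul_comm]
    exact linfNorm_le (mul_nonneg hr hθ.le) fun X => (fip_of_apply_single h X).trans_le (hh X)
end
end
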